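/- arXiv:1711.11322 — 3 statements merged into one kernel-verified Lean document; each statement's English description precedes it below -/
import Mathlib

section
/- Let p ≥ 2 and let T be a semistandard skew tableau of form 𝒜 with p columns satisfying the lattice property. Let b be a box of T in the k-th column lying in the body of T, where 1 ≤ k ≤ p−1, and let e be the entry of b. Then the word w(b) contains the letter e at least p−k times. -/
open Finset

namespace SkewTableau2

/-- A box of the skew diagram `λ/μ` (rows indexed `1, …, r` from the top, columns
indexed by positive integers from the left): `(i, j)` is a box iff `1 ≤ i ≤ r` and
`μ i < j ≤ λ i`. -/
def IsBox (r : ℕ) (lam mu : ℕ → ℕ) (i j : ℕ) : Prop :=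
  1 ≤ i ∧ i ≤ r ∧ mu i < j ∧ j ≤ lam i

instance (r : ℕ) (lam mu : ℕ → ℕ) (i j : ℕ) : Decidable (IsBox r lam mu i j) := by
  unfold IsBox; infer_instance

/-- `λ` and `μ` are partitions with `μ ⊆ λ`. -/
def IsSkewShape (lam mu : ℕ → ℕ) : Prop :=
  (∀ i, lam (i + 1) ≤ lam i) ∧ (∀ i, mu (i + 1) ≤ mu i) ∧ (∀ i, mu i ≤ lam i)

/-- The number of occurrences of the letter `a` in the reading word prefix `w(b)` ending
at the box `b = (i, j)`: the reading word is obtained by reading the filling `T` row by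
row from top to bottom, each row from right to left, so the prefix `w(i, j)` consists of
all boxes `(i', j')` with `i' < i`, or `i' = i` and `j' ≥ j`. -/
def prefixCount (r : ℕ) (lam mu : ℕ → ℕ) (T : ℕ → ℕ → ℕ) (a i j : ℕ) : ℕ :=
  ∑ i' ∈ Finset.Icc 1 r, ((Finset.Ioc (mu i') (lam i')).filter
      (fun j' => T i' j' = a ∧ (i' < i ∨ (i' = i ∧ j ≤ j')))).card

/-- The filling `T` is a semistandard skew tableau: its entries weakly increase along
each row from left to right and strictly increase down each column. -/
def Semistandard (r : ℕ) (lam mu : ℕ → ℕ) (T : ℕ → ℕ → ℕ) : Prop :=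
  (∀ i j, IsBox r lam mu i j → IsBox r lam mu i (j + 1) → T i j ≤ T i (j + 1)) ∧
  (∀ i j, IsBox r lam mu i j → IsBox r lam mu (i + 1) j → T i j < T (i + 1) j)

/-- The skew tableau `T` satisfies the lattice property: for every box `b` and every
letter `a ≥ 1`, the reading word prefix `w(b)` contains the letter `a` at least as many
times as the letter `a + 1`. -/
def Lattice (r : ℕ) (lam mu : ℕ → ℕ) (T : ℕ → ℕ → ℕ) : Prop :=
  ∀ i j a, IsBox r lam mu i j → 1 ≤ a →
    prefixCount r lam mu T (a + 1) i j ≤ prefixCount r lam mu T a i j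

/-- The skew diagram is of form `𝒜` with `p` columns, with body consisting of the boxes
in columns `1, …, p-1` lying in rows `≤ m`: every box lies in one of the columns
`1, …, p` (the `p`-th column may be empty), each of the columns `1, …, p-1` is nonempty,
every box in columns `1, …, p-2` lying in a row `≤ m` has a box immediately to its
right, and the second column contains no box in row `m + 1`. -/
def FormA (r : ℕ) (lam mu : ℕ → ℕ) (p m : ℕ) : Prop :=
  (∀ i j, IsBox r lam mu i j → j ≤ p) ∧
  (∀ j, 1 ≤ j → j ≤ p - 1 → ∃ i, IsBox r lam mu i j) ∧
  (∀ i j, IsBox r lam mu i j → j ≤ p - 2 → i ≤ m → IsBox r lam mu i (j + 1)) ∧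
  ¬ IsBox r lam mu (m + 1) 2

/-- Reading one more box whose entry is `a` increases the number of occurrences of `a`. -/
theorem prefixCount_lt_of_entry {r : ℕ} {lam mu : ℕ → ℕ} {T : ℕ → ℕ → ℕ} {i j : ℕ}
    (hbox : IsBox r lam mu i j) :
    prefixCount r lam mu T (T i j) i (j + 1) < prefixCount r lam mu T (T i j) i j := by
  obtain ⟨h1, hr, hmu, hlam⟩ := hbox
  unfold prefixCount
  refine Finset.sum_lt_sum (fun i' _ => Finset.card_le_card ?_)
    ⟨i, Finset.mem_Icc.mpr ⟨h1, hr⟩, Finset.card_lt_card ?_⟩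
  · exact Finset.monotone_filter_right _ fun j' _ h => ⟨h.1, by have := h.2; omega⟩
  · refine Finset.ssubset_iff_of_subset
      (Finset.monotone_filter_right _ fun j' _ h => ⟨h.1, by have := h.2; omega⟩) |>.mpr
      ⟨j, ?_, ?_⟩
    · simp [hmu, hlam]
    · simp

/-- Under the lattice property, a smaller letter occurs at least as often as a larger one in
every prefix of the reading word. -/
theorem Lattice.prefixCount_anti {r : ℕ} {lam mu : ℕ → ℕ} {T : ℕ → ℕ → ℕ}
    (hlat : Lattice r lam mu T) {i j a b : ℕ} (hbox : IsBox r lam mu i j)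
    (ha : 1 ≤ a) (hab : a ≤ b) :
    prefixCount r lam mu T b i j ≤ prefixCount r lam mu T a i j := by
  induction b, hab using Nat.le_induction with
  | base => exact le_rfl
  | succ b hab ih => exact (hlat i j b hbox (ha.trans hab)).trans ih

/--
**Lemma 3.2.**
Let `p ≥ 2` and let `T` be a semistandard skew tableau of form `𝒜` with `p` columns
satisfying the lattice property. Let `b = (i, k)` be a box of `T` in the `k`-th column
lying in the body of `T` (i.e. in a row `i ≤ m`), where `1 ≤ k ≤ p - 1`, and let
`e = T i k` be the entry of `b`. Then the word `w(b)` contains the letter `e` at least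
`p - k` times.
-/
theorem formA_entry_appears_at_least
    (p r m : ℕ) (hp : 2 ≤ p) (lam mu : ℕ → ℕ) (T : ℕ → ℕ → ℕ)
    (hshape : IsSkewShape lam mu)
    (hpos : ∀ i j, IsBox r lam mu i j → 1 ≤ T i j)
    (hss : Semistandard r lam mu T)
    (hlat : Lattice r lam mu T)
    (hA : FormA r lam mu p m)
    (k i : ℕ) (hk1 : 1 ≤ k) (hk2 : k ≤ p - 1)
    (hbox : IsBox r lam mu i k) (hbody : i ≤ m) :
    p - k ≤ prefixCount r lam mu T (T i k) i k := by
  induction hk2 using Nat.decreasingInduction with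
  | self =>
    have := prefixCount_lt_of_entry (T := T) hbox
    omega
  | of_succ k hk ih =>
    have hright : IsBox r lam mu i (k + 1) := hA.2.2.1 i k hbox (by omega) hbody
    have hrec := ih (by omega) hright
    have hle := hlat.prefixCount_anti hright (hpos i k hbox) (hss.1 i k hbox hright)
    have hlt := prefixCount_lt_of_entry (T := T) hbox
    omega

end SkewTableau2
end

section
/- Let p ≥ 3 and let T be a semistandard skew tableau of form 𝒜 with p columns satisfying the lattice property. Let 1 ≤ k ≤ p−2 and let b be a box of T in the k-th column lying inside the body of T, with entry e. If the box immediately to the right of b is the h-th box (counted from the top) of the (k+1)-th column of T, then e ≤ h. -/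
open Finset

namespace SkewTableau3

/-- A box of the skew diagram `λ/μ` (rows indexed `1, …, r` from the top, columns
indexed by positive integers from the left): `(i, j)` is a box iff `1 ≤ i ≤ r` and
`μ i < j ≤ λ i`. -/
def IsBox (r : ℕ) (lam mu : ℕ → ℕ) (i j : ℕ) : Prop :=
  1 ≤ i ∧ i ≤ r ∧ mu i < j ∧ j ≤ lam i

instance (r : ℕ) (lam mu : ℕ → ℕ) (i j : ℕ) : Decidable (IsBox r lam mu i j) := by
  unfold IsBox; infer_instance

/-- `λ` and `μ` are partitions with `μ ⊆ λ`. -/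
def IsSkewShape (lam mu : ℕ → ℕ) : Prop :=
  (∀ i, lam (i + 1) ≤ lam i) ∧ (∀ i, mu (i + 1) ≤ mu i) ∧ (∀ i, mu i ≤ lam i)

/-- The number of occurrences of the letter `a` in the reading word prefix `w(b)` ending
at the box `b = (i, j)`: the reading word is obtained by reading the filling `T` row by
row from top to bottom, each row from right to left, so the prefix `w(i, j)` consists of
all boxes `(i', j')` with `i' < i`, or `i' = i` and `j' ≥ j`. -/
def prefixCount (r : ℕ) (lam mu : ℕ → ℕ) (T : ℕ → ℕ → ℕ) (a i j : ℕ) : ℕ :=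
  ∑ i' ∈ Finset.Icc 1 r, ((Finset.Ioc (mu i') (lam i')).filter
      (fun j' => T i' j' = a ∧ (i' < i ∨ (i' = i ∧ j ≤ j')))).card

/-- The filling `T` is a semistandard skew tableau: its entries weakly increase along
each row from left to right and strictly increase down each column. -/
def Semistandard (r : ℕ) (lam mu : ℕ → ℕ) (T : ℕ → ℕ → ℕ) : Prop :=
  (∀ i j, IsBox r lam mu i j → IsBox r lam mu i (j + 1) → T i j ≤ T i (j + 1)) ∧
  (∀ i j, IsBox r lam mu i j → IsBox r lam mu (i + 1) j → T i j < T (i + 1) j)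

/-- The skew tableau `T` satisfies the lattice property: for every box `b` and every
letter `a ≥ 1`, the reading word prefix `w(b)` contains the letter `a` at least as many
times as the letter `a + 1`. -/
def Lattice (r : ℕ) (lam mu : ℕ → ℕ) (T : ℕ → ℕ → ℕ) : Prop :=
  ∀ i j a, IsBox r lam mu i j → 1 ≤ a →
    prefixCount r lam mu T (a + 1) i j ≤ prefixCount r lam mu T a i j

/-- The skew diagram is of form `𝒜` with `p` columns, with body consisting of the boxes
in columns `1, …, p-1` lying in rows `≤ m`: every box lies in one of the columns
`1, …, p` (the `p`-th column may be empty), each of the columns `1, …, p-1` is nonempty,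
every box in columns `1, …, p-2` lying in a row `≤ m` has a box immediately to its
right, and the second column contains no box in row `m + 1`. -/
def FormA (r : ℕ) (lam mu : ℕ → ℕ) (p m : ℕ) : Prop :=
  (∀ i j, IsBox r lam mu i j → j ≤ p) ∧
  (∀ j, 1 ≤ j → j ≤ p - 1 → ∃ i, IsBox r lam mu i j) ∧
  (∀ i j, IsBox r lam mu i j → j ≤ p - 2 → i ≤ m → IsBox r lam mu i (j + 1)) ∧
  ¬ IsBox r lam mu (m + 1) 2

/-- The letter `a` occurs in column `j`. -/
def ColumnMem (r : ℕ) (lam mu : ℕ → ℕ) (T : ℕ → ℕ → ℕ) (j a : ℕ) : Prop :=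
  ∃ i, IsBox r lam mu i j ∧ T i j = a

/-- The number of occurrences of the letter `a` in the columns `≥ j`. -/
def columnsCount (r : ℕ) (lam mu : ℕ → ℕ) (T : ℕ → ℕ → ℕ) (j a : ℕ) : ℕ :=
  ∑ i ∈ Finset.Icc 1 r, ((Finset.Ioc (mu i) (lam i)).filter
    (fun j' => T i j' = a ∧ j ≤ j')).card

section

variable {r : ℕ} {lam mu : ℕ → ℕ} {T : ℕ → ℕ → ℕ}

theorem IsBox.of_between {i i' i'' j : ℕ} (hshape : IsSkewShape lam mu)
    (h1 : IsBox r lam mu i j) (h2 : IsBox r lam mu i'' j) (hi : i ≤ i') (hi' : i' ≤ i'') :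
    IsBox r lam mu i' j := by
  have hl : lam i'' ≤ lam i' := antitone_nat_of_succ_le hshape.1 hi'
  have hm : mu i' ≤ mu i := antitone_nat_of_succ_le hshape.2.1 hi
  unfold IsBox at *
  omega

theorem Semistandard.row_le {i j j' : ℕ} (hss : Semistandard r lam mu T) (hj : j ≤ j')
    (h1 : IsBox r lam mu i j) (h2 : IsBox r lam mu i j') : T i j ≤ T i j' := by
  induction j', hj using Nat.le_induction with
  | base => exact le_rfl
  | succ n hn ih =>
    have hb : IsBox r lam mu i n := by unfold IsBox at *; omega
    exact (ih hb).trans (hss.1 i n hb h2)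

theorem Semistandard.col_lt {i i' j : ℕ} (hshape : IsSkewShape lam mu)
    (hss : Semistandard r lam mu T) (hi : i < i')
    (h1 : IsBox r lam mu i j) (h2 : IsBox r lam mu i' j) : T i j < T i' j := by
  induction i', hi using Nat.le_induction with
  | base => exact hss.2 i j h1 h2
  | succ n hn ih =>
    have hb : IsBox r lam mu n j := h1.of_between hshape h2 (by omega) (by omega)
    exact (ih hb).trans (hss.2 n j hb h2)

theorem Semistandard.row_le_of_entry_le {i i' j : ℕ} (hshape : IsSkewShape lam mu)
    (hss : Semistandard r lam mu T) (h1 : IsBox r lam mu i j) (h2 : IsBox r lam mu i' j)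
    (h : T i j ≤ T i' j) : i ≤ i' := by
  by_contra! hlt
  exact absurd (hss.col_lt hshape hlt h2 h1) (by omega)

open Classical in
theorem card_column_filter (hshape : IsSkewShape lam mu) (hss : Semistandard r lam mu T)
    (j a : ℕ) :
    ((Finset.Icc 1 r).filter (fun i => IsBox r lam mu i j ∧ T i j = a)).card =
      if ColumnMem r lam mu T j a then 1 else 0 := by
  split_ifs with h
  · obtain ⟨i, hi, rfl⟩ := h
    rw [Finset.card_eq_one]
    refine ⟨i, ?_⟩
    ext i'
    simp only [Finset.mem_filter, Finset.mem_Icc, Finset.mem_singleton]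
    constructor
    · rintro ⟨-, hb, he⟩
      exact le_antisymm (hss.row_le_of_entry_le hshape hb hi he.le)
        (hss.row_le_of_entry_le hshape hi hb he.ge)
    · rintro rfl
      exact ⟨⟨hi.1, hi.2.1⟩, hi, rfl⟩
  · rw [Finset.card_eq_zero, Finset.filter_eq_empty_iff]
    intro i _ hi
    exact h ⟨i, hi⟩

open Classical in
theorem columnsCount_eq_add (hshape : IsSkewShape lam mu) (hss : Semistandard r lam mu T)
    (j a : ℕ) :
    columnsCount r lam mu T j a =
      columnsCount r lam mu T (j + 1) a + if ColumnMem r lam mu T j a then 1 else 0 := by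
  rw [← card_column_filter hshape hss, Finset.card_filter, columnsCount, columnsCount,
    ← Finset.sum_add_distrib]
  refine Finset.sum_congr rfl fun i hi => ?_
  rw [Finset.mem_Icc] at hi
  split_ifs with h
  · have hnot : j ∉ (Finset.Ioc (mu i) (lam i)).filter (fun j' => T i j' = a ∧ j + 1 ≤ j') := by
      simp
    rw [← Finset.card_insert_of_notMem hnot]
    congr 1
    ext j'
    simp only [Finset.mem_filter, Finset.mem_Ioc, Finset.mem_insert]
    constructor
    · rintro ⟨h1, h2, h3⟩
      rcases h3.eq_or_lt with h4 | h4
      · exact Or.inl h4.symm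
      · exact Or.inr ⟨h1, h2, h4⟩
    · rintro (rfl | ⟨h1, h2, h3⟩)
      · exact ⟨⟨h.1.2.2.1, h.1.2.2.2⟩, h.2, le_rfl⟩
      · exact ⟨h1, h2, by omega⟩
  · rw [add_zero]
    congr 1
    ext j'
    simp only [Finset.mem_filter, Finset.mem_Ioc]
    constructor
    · rintro ⟨h1, h2, h3⟩
      rcases h3.eq_or_lt with rfl | h4
      · exact absurd ⟨⟨hi.1, hi.2, h1⟩, h2⟩ h
      · exact ⟨h1, h2, h4⟩
    · rintro ⟨h1, h2, h3⟩
      exact ⟨h1, h2, by omega⟩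

theorem columnsCount_eq_zero {p j : ℕ} (hp : ∀ i j, IsBox r lam mu i j → j ≤ p) (hj : p < j)
    (a : ℕ) : columnsCount r lam mu T j a = 0 := by
  refine Finset.sum_eq_zero fun i hi => ?_
  rw [Finset.mem_Icc] at hi
  rw [Finset.card_eq_zero, Finset.filter_eq_empty_iff]
  rintro j' hj' ⟨-, h⟩
  rw [Finset.mem_Ioc] at hj'
  have := hp i j' ⟨hi.1, hi.2, hj'⟩
  omega

/-- If column `j` contains `a + 1` but not `a`, then the columns to its right contain more
letters `a` than letters `a + 1`. -/
theorem Lattice.columnsCount_lt (hshape : IsSkewShape lam mu) (hss : Semistandard r lam mu T)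
    (hlat : Lattice r lam mu T) {j a : ℕ} (ha : 1 ≤ a)
    (h1 : ColumnMem r lam mu T j (a + 1)) (h0 : ¬ ColumnMem r lam mu T j a) :
    columnsCount r lam mu T (j + 1) (a + 1) < columnsCount r lam mu T (j + 1) a := by
  obtain ⟨x, hx, hTx⟩ := h1
  have hupper : prefixCount r lam mu T a x j ≤ columnsCount r lam mu T (j + 1) a := by
    refine Finset.sum_le_sum fun i hi => Finset.card_le_card fun j' hj' => ?_
    rw [Finset.mem_Icc] at hi
    simp only [Finset.mem_filter, Finset.mem_Ioc] at hj' ⊢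
    obtain ⟨hb, hT, hpre⟩ := hj'
    refine ⟨hb, hT, ?_⟩
    by_contra! hlt
    have hix : i ≤ x := by omega
    have hl : lam x ≤ lam i := antitone_nat_of_succ_le hshape.1 hix
    have hij : IsBox r lam mu i j := by unfold IsBox at *; omega
    have hle := hss.row_le (by omega : j' ≤ j) ⟨hi.1, hi.2, hb⟩ hij
    rcases hix.eq_or_lt with rfl | hix
    · exact h0 ⟨i, hij, by rw [← hT, show j' = j by omega]⟩
    · have := hss.col_lt hshape hix hij hx
      exact h0 ⟨i, hij, by omega⟩
  have hlower : columnsCount r lam mu T (j + 1) (a + 1) + 1 ≤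
      prefixCount r lam mu T (a + 1) x j := by
    have hone : (∑ i ∈ Finset.Icc 1 r, if i = x then 1 else 0) = 1 := by
      rw [Finset.sum_ite_eq', if_pos (Finset.mem_Icc.2 ⟨hx.1, hx.2.1⟩)]
    rw [columnsCount]
    conv_lhs => rhs; rw [← hone]
    rw [← Finset.sum_add_distrib]
    refine Finset.sum_le_sum fun i hi => ?_
    rw [Finset.mem_Icc] at hi
    have hsub : ∀ j' ∈ (Finset.Ioc (mu i) (lam i)).filter
        (fun j' => T i j' = a + 1 ∧ j + 1 ≤ j'),
        j' ∈ (Finset.Ioc (mu i) (lam i)).filter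
          (fun j' => T i j' = a + 1 ∧ (i < x ∨ (i = x ∧ j ≤ j'))) := by
      intro j' hj'
      simp only [Finset.mem_filter, Finset.mem_Ioc] at hj' ⊢
      obtain ⟨hb, hT, hjj⟩ := hj'
      refine ⟨hb, hT, ?_⟩
      by_contra! hcon
      have hxi : x < i := by omega
      have hl : lam i ≤ lam x := antitone_nat_of_succ_le hshape.1 hxi.le
      have hxj : IsBox r lam mu x j' := by unfold IsBox at *; omega
      have h2 := hss.row_le (by omega : j ≤ j') hx hxj
      have h3 := hss.col_lt hshape hxi hxj ⟨hi.1, hi.2, hb⟩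
      omega
    split_ifs with hix
    · subst hix
      have hnot : j ∉ (Finset.Ioc (mu i) (lam i)).filter
          (fun j' => T i j' = a + 1 ∧ j + 1 ≤ j') := by simp
      rw [← Finset.card_insert_of_notMem hnot]
      refine Finset.card_le_card (Finset.insert_subset ?_ hsub)
      simp only [Finset.mem_filter, Finset.mem_Ioc]
      exact ⟨hx.2.2, hTx, Or.inr ⟨trivial, le_rfl⟩⟩
    · exact Finset.card_le_card hsub
  have := hlat x j a hx ha
  omega

end

open Classical in
/-- If, below `M ∈ S`, a gap of `S` can end only at `y' + 1`, then moving the letter `y'` to the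
end `y` of the initial segment of `S` balances the indicator functions of `a` and `a + 1`. -/
theorem exists_initial_segment {S : ℕ → Prop} {M y' : ℕ} (hM : S M)
    (hgap : ∀ a, 1 ≤ a → a < M → S (a + 1) → ¬ S a → a = y') :
    ∃ y, ∀ a, 1 ≤ a → a < M →
      ((if a = y' then 1 else 0) + (if S a then 1 else 0) =
        (if S (a + 1) then 1 else 0) + if a = y then 1 else 0) ∧
      (a = y → ∀ b, 1 ≤ b → b ≤ a → S b) := by
  by_cases hall : ∀ b, 1 ≤ b → b ≤ M → S b
  · refine ⟨y', fun a ha haM => ⟨?_, fun _ b hb hba => hall b hb (by omega)⟩⟩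
    rw [if_pos (hall a ha haM.le), if_pos (hall (a + 1) (by omega) haM), add_comm]
  · have hex : ∃ y, ¬ S (y + 1) ∧ y + 1 ≤ M := by
      push Not at hall
      obtain ⟨b, hb, hbM, hSb⟩ := hall
      exact ⟨b - 1, by rwa [Nat.sub_add_cancel hb], by omega⟩
    obtain ⟨hyS, hyM⟩ := Nat.find_spec hex
    have hmin := fun b (hb : b < Nat.find hex) => Nat.find_min hex hb
    set y := Nat.find hex
    have hinit : ∀ b, 1 ≤ b → b ≤ y → S b := by
      intro b hb hby
      have := hmin (b - 1) (by omega)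
      rw [Nat.sub_add_cancel hb] at this
      by_contra hSb
      exact this ⟨hSb, by omega⟩
    have hhigh : ∀ a, a ≤ M → y' < a → y < a → S a := by
      intro a haM
      induction haM using Nat.decreasingInduction with
      | self => exact fun _ _ => hM
      | of_succ n hn ih =>
        intro h1 h2
        by_contra hSn
        have := hgap n (by omega) hn (ih (by omega) (by omega)) hSn
        omega
    have hyy' : y < y' := by
      by_contra! hle
      exact hyS (hhigh (y + 1) hyM (by omega) (by omega))
    have hlow : ∀ a, y + 1 ≤ a → a ≤ y' → a ≤ M → ¬ S a := by
      intro a hya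
      induction a, hya using Nat.le_induction with
      | base => exact fun _ _ => hyS
      | succ n hn ih =>
        intro h1 h2 hS
        have := hgap n (by omega) (by omega) hS (ih (by omega) (by omega))
        omega
    refine ⟨y, fun a ha haM => ⟨?_, fun h b hb hba => hinit b hb (by omega)⟩⟩
    have hS : ∀ b, 1 ≤ b → b ≤ M → (S b ↔ b ≤ y ∨ y' < b) := by
      intro b hb hbM
      refine ⟨fun h => ?_, fun h => h.elim (hinit b hb) fun h => hhigh b hbM h (by omega)⟩
      by_contra! hcon
      exact hlow b hcon.1 hcon.2 hbM h
    simp only [hS a ha haM.le, hS (a + 1) (by omega) haM]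
    split_ifs <;> omega

/-- For a downward closed set of positive integers, the indicator function drops only at the
end of the set. -/
theorem exists_indicator_drop {S : ℕ → Prop} [DecidablePred S]
    (hS : ∀ a, 1 ≤ a → S (a + 1) → S a) (M : ℕ) :
    ∃ y, ∀ a, 1 ≤ a → a < M →
      (if S a then 1 else 0) = (if S (a + 1) then 1 else 0) + if a = y then 1 else 0 := by
  have hiff : ∀ a, 1 ≤ a → a ≤ M → (S a ↔ a ≤ Nat.findGreatest S M) := by
    intro a ha haM
    refine ⟨fun h => Nat.le_findGreatest haM h, fun h => ?_⟩
    have hg : S (Nat.findGreatest S M) := Nat.findGreatest_of_ne_zero rfl (by omega)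
    induction h using Nat.decreasingInduction with
    | self => exact hg
    | of_succ n hn ih =>
      exact hS n ha (ih (by omega) (Nat.lt_of_lt_of_le hn (Nat.findGreatest_le M)))
  refine ⟨Nat.findGreatest S M, fun a ha haM => ?_⟩
  simp only [hiff a ha haM.le, hiff (a + 1) (by omega) haM]
  split_ifs <;> omega

section

variable {r : ℕ} {lam mu : ℕ → ℕ} {T : ℕ → ℕ → ℕ}

theorem exists_columnsCount_drop_last {p : ℕ} (hshape : IsSkewShape lam mu)
    (hss : Semistandard r lam mu T) (hlat : Lattice r lam mu T)
    (hp : ∀ i j, IsBox r lam mu i j → j ≤ p) (M : ℕ) :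
    ∃ y, ∀ a, 1 ≤ a → a < M → columnsCount r lam mu T p a =
      columnsCount r lam mu T p (a + 1) + if a = y then 1 else 0 := by
  classical
  have hzero := columnsCount_eq_zero (T := T) hp (Nat.lt_succ_self p)
  obtain ⟨y, hy⟩ := exists_indicator_drop (S := ColumnMem r lam mu T p) (fun a ha h1 => by
    by_contra h0
    have := hlat.columnsCount_lt hshape hss ha h1 h0
    simp [hzero] at this) M
  refine ⟨y, fun a ha haM => ?_⟩
  rw [columnsCount_eq_add hshape hss, columnsCount_eq_add hshape hss p (a + 1), hzero, hzero,
    zero_add, zero_add]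
  convert hy a ha haM

theorem exists_columnsCount_drop_of_succ {i j y' : ℕ} (hshape : IsSkewShape lam mu)
    (hss : Semistandard r lam mu T) (hlat : Lattice r lam mu T) (hbox : IsBox r lam mu i j)
    (hy' : ∀ a, 1 ≤ a → a < T i j → columnsCount r lam mu T (j + 1) a =
      columnsCount r lam mu T (j + 1) (a + 1) + if a = y' then 1 else 0) :
    ∃ y, ∀ a, 1 ≤ a → a < T i j →
      (columnsCount r lam mu T j a =
        columnsCount r lam mu T j (a + 1) + if a = y then 1 else 0) ∧
      (a = y → ∀ b, 1 ≤ b → b ≤ a → ColumnMem r lam mu T j b) := by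
  classical
  obtain ⟨y, hy⟩ := exists_initial_segment (S := ColumnMem r lam mu T j) (y' := y')
    ⟨i, hbox, rfl⟩ (fun a ha haM h1 h0 => by
      have h2 := hlat.columnsCount_lt hshape hss ha h1 h0
      have h3 := hy' a ha haM
      by_contra hne
      rw [if_neg hne] at h3
      omega)
  refine ⟨y, fun a ha haM => ⟨?_, (hy a ha haM).2⟩⟩
  have h1 := (hy a ha haM).1
  have h2 := hy' a ha haM
  rw [columnsCount_eq_add hshape hss, columnsCount_eq_add hshape hss j (a + 1)]
  omega

end

/--
**Lemma 3.3.**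
Let `p ≥ 3` and let `T` be a semistandard skew tableau of form `𝒜` with `p` columns
satisfying the lattice property. Let `1 ≤ k ≤ p - 2` and let `b = (i, k)` be a box of
`T` in the `k`-th column lying inside the body of `T` (i.e. in a row `i ≤ m`), with
entry `e = T i k`. If the box immediately to the right of `b` is the `h`-th box
(counted from the top) of the `(k+1)`-th column of `T`, then `e ≤ h`.
-/
theorem formA_entry_le_height
    (p r m : ℕ) (hp : 3 ≤ p) (lam mu : ℕ → ℕ) (T : ℕ → ℕ → ℕ)
    (hshape : IsSkewShape lam mu)
    (hpos : ∀ i j, IsBox r lam mu i j → 1 ≤ T i j)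
    (hss : Semistandard r lam mu T)
    (hlat : Lattice r lam mu T)
    (hA : FormA r lam mu p m)
    (k i : ℕ) (hk1 : 1 ≤ k) (hk2 : k ≤ p - 2)
    (hbox : IsBox r lam mu i k) (hbody : i ≤ m)
    (h : ℕ)
    (hh : h = ((Finset.Icc 1 r).filter
      (fun i' => IsBox r lam mu i' (k + 1) ∧ i' ≤ i)).card) :
    T i k ≤ h := by
  classical
  obtain ⟨hcol, -, hright, -⟩ := hA
  have hrow : ∀ j, k ≤ j → j ≤ p - 1 → IsBox r lam mu i j := by
    intro j hkj
    induction j, hkj using Nat.le_induction with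
    | base => exact fun _ => hbox
    | succ n hn ih => exact fun hnp => hright i n (ih (by omega)) (by omega) hbody
  have hdrop : ∀ j, j ≤ p - 1 → k + 1 ≤ j → ∃ y, ∀ a, 1 ≤ a → a < T i j →
      (columnsCount r lam mu T j a =
        columnsCount r lam mu T j (a + 1) + if a = y then 1 else 0) ∧
      (a = y → ∀ b, 1 ≤ b → b ≤ a → ColumnMem r lam mu T j b) := by
    intro j hj
    induction hj using Nat.decreasingInduction with
    | self =>
      intro hk
      obtain ⟨y, hy⟩ := exists_columnsCount_drop_last hshape hss hlat hcol (T i (p - 1))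
      refine exists_columnsCount_drop_of_succ (y' := y) hshape hss hlat
        (hrow _ (by omega) le_rfl) ?_
      rwa [Nat.sub_add_cancel (by omega)]
    | of_succ n hn ih =>
      intro hk
      obtain ⟨y, hy⟩ := ih (by omega)
      have hle := hss.1 i n (hrow n (by omega) (by omega)) (hrow (n + 1) (by omega) (by omega))
      exact exists_columnsCount_drop_of_succ (y' := y) hshape hss hlat
        (hrow n (by omega) (by omega)) fun a ha haM => (hy a ha (by omega)).1
  obtain ⟨y, hy⟩ := hdrop (k + 1) (by omega) le_rfl
  have hbox' := hrow (k + 1) (by omega) (by omega)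
  have hle := hss.1 i k hbox hbox'
  have hbelow : ∀ x, IsBox r lam mu x k → x ≤ i → IsBox r lam mu x (k + 1) := by
    intro x hx hxi
    have hl : lam i ≤ lam x := antitone_nat_of_succ_le hshape.1 hxi
    unfold IsBox at *
    omega
  -- `c` is the largest letter below `T i k` missing in column `k`, or `0` if there is none.
  obtain ⟨c, hc, hc'⟩ : ∃ c, (∀ b, 1 ≤ b → b ≤ c → ColumnMem r lam mu T (k + 1) b) ∧
      ∀ b, c < b → b ≤ T i k → ColumnMem r lam mu T k b := by
    set P : ℕ → Prop := fun b => ¬ ColumnMem r lam mu T k b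
    set c := Nat.findGreatest P (T i k) with hcdef
    have habove : ∀ b, c < b → b ≤ T i k → ColumnMem r lam mu T k b := fun b hb hbe =>
      not_not.1 (Nat.findGreatest_is_greatest hb hbe)
    refine ⟨c, fun b hb hbc => ?_, habove⟩
    have hcS : P c := Nat.findGreatest_of_ne_zero hcdef.symm (by omega)
    have hce : c ≤ T i k := Nat.findGreatest_le _
    have hne : c ≠ T i k := fun h => hcS ⟨i, hbox, h.symm⟩
    have hlt := hlat.columnsCount_lt hshape hss (by omega) (habove (c + 1) (by omega) (by omega))
      hcS
    obtain ⟨hyc, hmem⟩ := hy c (by omega) (by omega)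
    refine hmem ?_ b hb hbc
    by_contra hcy
    rw [if_neg hcy] at hyc
    omega
  have hrows : ∀ b ∈ Finset.Icc 1 (T i k), ∃ x, IsBox r lam mu x (k + 1) ∧ x ≤ i ∧
      (b ≤ c ∧ T x (k + 1) = b ∨ c < b ∧ IsBox r lam mu x k ∧ T x k = b) := by
    intro b hb
    rw [Finset.mem_Icc] at hb
    rcases le_or_gt b c with hbc | hbc
    · obtain ⟨x, hx, hTx⟩ := hc b hb.1 hbc
      exact ⟨x, hx, hss.row_le_of_entry_le hshape hx hbox' (by omega), Or.inl ⟨hbc, hTx⟩⟩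
    · obtain ⟨x, hx, hTx⟩ := hc' b hbc hb.2
      have hxi := hss.row_le_of_entry_le hshape hx hbox (by omega)
      exact ⟨x, hbelow x hx hxi, hxi, Or.inr ⟨hbc, hx, hTx⟩⟩
  choose! f hf using hrows
  rw [hh]
  calc T i k = (Finset.Icc 1 (T i k)).card := by simp
    _ ≤ _ := Finset.card_le_card_of_injOn f (fun b hb => by
        obtain ⟨h1, h2, -⟩ := hf b hb
        simpa using ⟨⟨h1.1, h1.2.1⟩, h1, h2⟩) (fun b hb b' hb' hbb' => by
        obtain ⟨h1, -, h2⟩ := hf b hb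
        obtain ⟨-, -, h3⟩ := hf b' hb'
        rw [← hbb'] at h3
        rcases h2 with ⟨h2, h4⟩ | ⟨h2, hk, h4⟩ <;> rcases h3 with ⟨h3, h5⟩ | ⟨h3, hk', h5⟩
        · omega
        · have := hss.1 _ _ hk' h1
          omega
        · have := hss.1 _ _ hk h1
          omega
        · omega)

end SkewTableau3
end

section
/- Let A be an n×n complex matrix with A^m = 1 for some positive integer m, and suppose that the trace of A^k is a rational number for every positive integer k. Then for every divisor d of m, every primitive d-th root of unity ζ, and every integer i coprime to d, the multiplicity of ζ as an eigenvalue of A equals the multiplicity of ζ^i as an eigenvalue of A. -/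
/-- For an endomorphism `f` with `f ^ m = 1`, the algebraic multiplicity of an `m`-th root of unity
`ζ` as an eigenvalue of `f` is a discrete Fourier transform of the traces of the powers of `f`. -/
theorem Module.End.sum_inv_pow_mul_trace_pow {K V : Type*} [Field K] [AddCommGroup V] [Module K V]
    [FiniteDimensional K V] {m : ℕ} (hm : (m : K) ≠ 0) (f : Module.End K V) (hf : f ^ m = 1)
    {ζ : K} (hζ : ζ ^ m = 1) :
    ∑ k ∈ Finset.range m, LinearMap.trace K V (f ^ k) * ζ⁻¹ ^ k
      = m * (f.charpoly.rootMultiplicity ζ : K) := by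
  have hζ0 : ζ ≠ 0 := by
    rintro rfl
    rw [zero_pow (by rintro rfl; simp at hm)] at hζ
    exact zero_ne_one hζ
  have hss : f.IsSemisimple := by
    refine isSemisimple_of_squarefree_aeval_eq_zero (p := Polynomial.X ^ m - 1) ?_ (by simp [hf])
    exact (Polynomial.X_pow_sub_one_separable_iff.mpr hm).squarefree
  set g : Module.End K V := ζ⁻¹ • f with hg
  have hgm : g ^ m = 1 := by rw [hg, smul_pow, hf, inv_pow, hζ, inv_one, one_smul]
  have hproj : LinearMap.IsProj (f.eigenspace ζ)
      ((m : K)⁻¹ • ∑ k ∈ Finset.range m, g ^ k) := by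
    refine ⟨fun x => ?_, fun x hx => ?_⟩
    · have h : (g - 1) * ∑ k ∈ Finset.range m, g ^ k = 0 := by rw [mul_geom_sum, hgm, sub_self]
      have h' := LinearMap.congr_fun h x
      rw [LinearMap.smul_apply]
      refine Submodule.smul_mem _ _ ?_
      rw [Module.End.mem_eigenspace_iff]
      simp only [Module.End.mul_apply, LinearMap.sub_apply, Module.End.one_apply,
        LinearMap.zero_apply, sub_eq_zero, hg, LinearMap.smul_apply] at h'
      exact (inv_smul_eq_iff₀ hζ0).mp h'
    · have hgx : g x = x := by
        rw [hg, LinearMap.smul_apply, Module.End.mem_eigenspace_iff.mp hx, inv_smul_smul₀ hζ0]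
      have hk : ∀ k : ℕ, (g ^ k) x = x := fun k => by
        rw [Module.End.pow_apply]
        exact Function.iterate_fixed hgx k
      rw [LinearMap.smul_apply, LinearMap.sum_apply, Finset.sum_congr rfl fun k _ => hk k,
        Finset.sum_const, Finset.card_range, ← Nat.cast_smul_eq_nsmul K, inv_smul_smul₀ hm]
  have htr := hproj.trace
  rw [← hss.isFinitelySemisimple.maxGenEigenspace_eq_eigenspace,
    LinearMap.finrank_maxGenEigenspace_eq, map_smul, map_sum, smul_eq_mul,
    inv_mul_eq_iff_eq_mul₀ hm] at htr
  rw [← htr]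
  refine Finset.sum_congr rfl fun k _ => ?_
  rw [hg, smul_pow, map_smul, smul_eq_mul, mul_comm]

/-- Primitive `d`-th roots of unity are conjugate over `ℚ`. -/
theorem IsPrimitiveRoot.aeval_eq_zero_of_aeval_eq_zero {K : Type*} [Field K] [CharZero K] {d : ℕ}
    (hd : 0 < d) {μ ν : K} (hμ : IsPrimitiveRoot μ d) (hν : IsPrimitiveRoot ν d)
    {p : Polynomial ℚ} (hp : Polynomial.aeval μ p = 0) : Polynomial.aeval ν p = 0 := by
  have hdvd := minpoly.dvd ℚ μ hp
  rw [← Polynomial.cyclotomic_eq_minpoly_rat hμ hd,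
    Polynomial.cyclotomic_eq_minpoly_rat hν hd] at hdvd
  exact Polynomial.aeval_eq_zero_of_dvd_aeval_eq_zero hdvd (minpoly.aeval ℚ ν)

/--
Let `A` be an `n × n` complex matrix with `A ^ m = 1` for some positive integer `m`
(so `A` is diagonalizable and all its eigenvalues are `m`-th roots of unity), and
suppose that the trace of `A ^ k` is a rational number for every positive integer `k`.
Then for every divisor `d` of `m`, every primitive `d`-th root of unity `ζ`, and every
integer `i` coprime to `d`, the multiplicity of `ζ` as an eigenvalue of `A` (i.e. its
multiplicity as a root of the characteristic polynomial of `A`) equals the multiplicity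
of `ζ ^ i` as an eigenvalue of `A`.
-/
theorem rootMultiplicity_charpoly_galois_invariant
    {n m : ℕ} (hm : 0 < m) (A : Matrix (Fin n) (Fin n) ℂ) (hA : A ^ m = 1)
    (htr : ∀ k : ℕ, 0 < k → ∃ r : ℚ, (A ^ k).trace = (r : ℂ))
    (d : ℕ) (hd : d ∣ m) (ζ : ℂ) (hζ : IsPrimitiveRoot ζ d)
    (i : ℤ) (hi : IsCoprime i (d : ℤ)) :
    (Matrix.charpoly A).rootMultiplicity ζ
      = (Matrix.charpoly A).rootMultiplicity (ζ ^ i) := by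
  have hd0 : 0 < d := Nat.pos_of_dvd_of_pos hd hm
  have hm0 : (m : ℂ) ≠ 0 := Nat.cast_ne_zero.mpr hm.ne'
  have hξ : IsPrimitiveRoot (ζ ^ i) d :=
    hζ.zpow_of_gcd_eq_one i (Int.isCoprime_iff_gcd_eq_one.mp hi)
  have htr' : ∀ k : ℕ, ∃ r : ℚ, (A ^ k).trace = (r : ℂ) := fun k => by
    rcases k.eq_zero_or_pos with rfl | hk
    · exact ⟨n, by simp⟩
    · exact htr k hk
  choose t ht using htr'
  have hsum : ∀ η : ℂ, IsPrimitiveRoot η d →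
      ∑ k ∈ Finset.range m, (t k : ℂ) * η⁻¹ ^ k = m * (A.charpoly.rootMultiplicity η : ℂ) := by
    intro η hη
    have h := Module.End.sum_inv_pow_mul_trace_pow hm0 (Matrix.toLin' A)
      (by rw [← Matrix.toLin'_pow, hA, Matrix.toLin'_one]; rfl) ((hη.pow_eq_one_iff_dvd m).mpr hd)
    simpa only [← Matrix.toLin'_pow, Matrix.trace_toLin'_eq, ht, Matrix.charpoly_toLin'] using h
  set p : Polynomial ℚ := ∑ k ∈ Finset.range m, Polynomial.C (t k) * Polynomial.X ^ k
    - Polynomial.C ((m : ℚ) * (A.charpoly.rootMultiplicity ζ : ℚ)) with hp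
  have hpη : ∀ η : ℂ, IsPrimitiveRoot η d → Polynomial.aeval η⁻¹ p
      = m * (A.charpoly.rootMultiplicity η : ℂ) - m * (A.charpoly.rootMultiplicity ζ : ℂ) := by
    intro η hη
    rw [← hsum η hη]
    simp [hp]
  have h := hζ.inv.aeval_eq_zero_of_aeval_eq_zero hd0 hξ.inv (p := p)
    (by rw [hpη ζ hζ, sub_self])
  rw [hpη _ hξ, sub_eq_zero] at h
  exact_mod_cast (mul_left_cancel₀ hm0 h).symm
end
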